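/- Let B ⊆ ℝ³ be open and let Y : B → ℝ³ be a smooth vector field. Then curl∘curl applied to the symmetrized gradient of Y vanishes identically: ε_{IKL} ε_{JMN} ∂_K ∂_M ( (∂_N Y^L + ∂_L Y^N)/2 ) = 0 on B for all I, J. -/

import Mathlib

/-- Partial derivative in the `K`-th coordinate direction. -/
noncomputable def pd {n : ℕ} (K : Fin n) (f : (Fin n → ℝ) → ℝ) (x : Fin n → ℝ) : ℝ :=
  fderiv ℝ f x (Pi.single K 1)

/-- The standard permutation symbol `ε_{ijk}` on `Fin 3`. -/
noncomputable def eps (i j k : Fin 3) : ℝ :=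
  (((j : ℕ) : ℝ) - ((i : ℕ) : ℝ)) * (((k : ℕ) : ℝ) - ((i : ℕ) : ℝ)) *
    (((k : ℕ) : ℝ) - ((j : ℕ) : ℝ)) / 2

theorem sum_eps_mul_eq_zero_of_symm (i : Fin 3) (T : Fin 3 → Fin 3 → ℝ)
    (hT : ∀ j k, T j k = T k j) : ∑ j, ∑ k, eps i j k * T j k = 0 := by
  have h : ∀ j k, eps i k j = -eps i j k := fun j k => by simp only [eps]; ring
  have h' : ∑ j, ∑ k, eps i j k * T j k = -∑ j, ∑ k, eps i j k * T j k := by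
    conv_lhs => rw [Finset.sum_comm]
    simp only [← Finset.sum_neg_distrib]
    refine Finset.sum_congr rfl fun j _ => Finset.sum_congr rfl fun k _ => ?_
    rw [h, hT k j, neg_mul]
  linarith

theorem ContDiffOn.pd {n : ℕ} {B : Set (Fin n → ℝ)} (hB : IsOpen B)
    {f : (Fin n → ℝ) → ℝ} (hf : ContDiffOn ℝ (⊤ : ℕ∞) f B) (K : Fin n) :
    ContDiffOn ℝ (⊤ : ℕ∞) (pd K f) B :=
  (hf.fderiv_of_isOpen hB (by simp)).clm_apply contDiffOn_const

theorem ContDiffOn.differentiableAt_of_isOpen {n : ℕ} {B : Set (Fin n → ℝ)} (hB : IsOpen B)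
    {f : (Fin n → ℝ) → ℝ} (hf : ContDiffOn ℝ (⊤ : ℕ∞) f B) {x : Fin n → ℝ} (hx : x ∈ B) :
    DifferentiableAt ℝ f x :=
  (hf.contDiffAt (hB.mem_nhds hx)).differentiableAt (by simp)

theorem pd_congr_of_eqOn {n : ℕ} {B : Set (Fin n → ℝ)} (hB : IsOpen B)
    {f g : (Fin n → ℝ) → ℝ} (h : Set.EqOn f g B) (K : Fin n) : Set.EqOn (pd K f) (pd K g) B :=
  fun x hx => by
    simp only [pd, (h.eventuallyEq_of_mem (hB.mem_nhds hx)).fderiv_eq]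

theorem pd_add_div_two {n : ℕ} {f g : (Fin n → ℝ) → ℝ} {x : Fin n → ℝ}
    (hf : DifferentiableAt ℝ f x) (hg : DifferentiableAt ℝ g x) (K : Fin n) :
    pd K (fun y => (f y + g y) / 2) x = (pd K f x + pd K g x) / 2 := by
  have h : HasFDerivAt (fun y => (f y + g y) * 2⁻¹)
      ((2⁻¹ : ℝ) • (fderiv ℝ f x + fderiv ℝ g x)) x :=
    (hf.hasFDerivAt.add hg.hasFDerivAt).mul_const _
  simp only [pd, div_eq_mul_inv, h.fderiv, smul_apply, add_apply, smul_eq_mul]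
  ring

theorem pd_comm {n : ℕ} {B : Set (Fin n → ℝ)} (hB : IsOpen B)
    {f : (Fin n → ℝ) → ℝ} (hf : ContDiffOn ℝ (⊤ : ℕ∞) f B) (K M : Fin n) :
    Set.EqOn (pd K (pd M f)) (pd M (pd K f)) B := by
  intro x hx
  have hf' : DifferentiableAt ℝ (fderiv ℝ f) x :=
    ((hf.fderiv_of_isOpen hB (m := (⊤ : ℕ∞)) (by simp)).contDiffAt
      (hB.mem_nhds hx)).differentiableAt (by simp)
  have key : ∀ K M : Fin n,
      pd K (pd M f) x = fderiv ℝ (fderiv ℝ f) x (Pi.single K 1) (Pi.single M 1) := by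
    intro K M
    have h := (hf'.hasFDerivAt.clm_apply (hasFDerivAt_const (Pi.single M (1 : ℝ)) x)).fderiv
    change fderiv ℝ (fun y => fderiv ℝ f y (Pi.single M 1)) x _ = _
    rw [h]
    simp
  rw [key, key]
  exact (hf.contDiffAt (hB.mem_nhds hx)).isSymmSndFDerivAt
    (minSmoothness_of_isRCLikeNormedField.trans_le <|
      WithTop.coe_le_coe.2 (le_top : (2 : ℕ∞) ≤ ⊤)) _ _

/-- `curl ∘ curl ∘ grad^s = 0`: for every smooth vector field `Y` on an open `B ⊆ ℝ³`,
`ε_{IKL} ε_{JMN} ∂_K ∂_M ((∂_N Y^L + ∂_L Y^N)/2) = 0` on `B`. -/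
theorem curl_curl_symmetrized_gradient_eq_zero
    (B : Set (Fin 3 → ℝ)) (hB : IsOpen B)
    (Y : (Fin 3 → ℝ) → Fin 3 → ℝ)
    (hY : ContDiffOn ℝ (⊤ : ℕ∞) Y B) :
    ∀ x ∈ B, ∀ I J,
      (∑ K, ∑ L, ∑ M, ∑ N, eps I K L * eps J M N *
        pd K (fun y => pd M (fun z =>
          (pd N (fun w => Y w L) z + pd L (fun w => Y w N) z) / 2) y) x) = 0 := by
  intro x hx I J
  have hc : ∀ L, ContDiffOn ℝ (⊤ : ℕ∞) (fun w => Y w L) B := contDiffOn_pi.1 hY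
  let D : Fin 3 → Fin 3 → Fin 3 → Fin 3 → ℝ :=
    fun K M N L => pd K (pd M (pd N fun w => Y w L)) x
  have hD₁ : ∀ K M N L, D K M N L = D M K N L := fun K M N L =>
    pd_comm hB ((hc L).pd hB N) K M hx
  have hD₂ : ∀ K M N L, D K M N L = D K N M L := fun K M N L =>
    pd_congr_of_eqOn hB (pd_comm hB (hc L) M N) K hx
  have hsplit : ∀ K L M N, pd K (fun y => pd M (fun z =>
      (pd N (fun w => Y w L) z + pd L (fun w => Y w N) z) / 2) y) x =
      (D K M N L + D K M L N) / 2 := by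
    intro K L M N
    have hNL := (hc L).pd hB N
    have hLN := (hc N).pd hB L
    refine (pd_congr_of_eqOn hB (fun y hy => pd_add_div_two
      (hNL.differentiableAt_of_isOpen hB hy) (hLN.differentiableAt_of_isOpen hB hy) M)
      K hx).trans ?_
    exact pd_add_div_two ((hNL.pd hB M).differentiableAt_of_isOpen hB hx)
      ((hLN.pd hB M).differentiableAt_of_isOpen hB hx) K
  have h₁ : ∑ K, ∑ L, ∑ M, ∑ N, eps I K L * eps J M N * D K M N L = 0 := by
    simp only [mul_assoc, ← Finset.mul_sum]
    refine Finset.sum_eq_zero fun K _ => Finset.sum_eq_zero fun L _ => ?_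
    rw [sum_eps_mul_eq_zero_of_symm J _ fun M N => hD₂ K M N L, mul_zero]
  have h₂ : ∑ K, ∑ L, ∑ M, ∑ N, eps I K L * eps J M N * D K M L N = 0 := by
    simp only [mul_assoc, ← Finset.mul_sum]
    refine sum_eps_mul_eq_zero_of_symm I _ fun K L => ?_
    refine Finset.sum_congr rfl fun M _ => Finset.sum_congr rfl fun N _ => ?_
    rw [hD₁ K M L N, hD₂ M K L N, hD₁ M L K N]
  simp only [hsplit, mul_div_assoc', mul_add, ← Finset.sum_div, Finset.sum_add_distrib, h₁, h₂,
    add_zero, zero_div]
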